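/- Let 1 < p < ∞ and let ν be a nonnegative Radon measure on a bounded open set Ω ⊂ ℝⁿ. Suppose there exists a function u ∈ W^{1,p}_loc(Ω), positive in Ω and bounded with M := sup_Ω u < ∞, which is a weak supersolution of −Δ_p u ≥ ν in Ω (i.e. ∫_Ω |∇u|^{p-2}∇u · ∇ψ dx ≥ ∫_Ω ψ dν for all nonnegative ψ ∈ C_c^∞(Ω)). Then for every nonnegative φ ∈ C_c^∞(Ω), ∫_Ω φ^p dν ≤ M^{p-1} ∫_Ω |∇φ|^p dx; in particular W_0^{1,p}(Ω) embeds into L^p(Ω; ν). -/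

import Mathlib

open MeasureTheory Metric Set Filter
open scoped ENNReal NNReal RealInnerProductSpace

/-- `ℝⁿ` as a Euclidean space. -/
abbrev Euc (n : ℕ) := EuclideanSpace ℝ (Fin n)

open scoped Convolution Topology

/-- Young's inequality in the form used for Picone's inequality. -/
theorem mul_rpow_mul_le_of_young {p s z : ℝ} (hp : 1 < p) (hs : 0 ≤ s) (hz : 0 ≤ z) :
    p * (s ^ (p - 1) * z) ≤ (p - 1) * s ^ p + z ^ p := by
  have hp0 : 0 < p := by linarith
  have hp1 : 0 < p - 1 := by linarith
  have h := Real.young_inequality_of_nonneg hz (Real.rpow_nonneg hs (p - 1))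
    (Real.HolderConjugate.conjExponent hp)
  have h2 : (s ^ (p - 1)) ^ (p.conjExponent) = s ^ p := by
    rw [← Real.rpow_mul hs, Real.conjExponent]
    congr 1
    field_simp
  rw [h2, Real.conjExponent] at h
  calc p * (s ^ (p - 1) * z) = p * (z * s ^ (p - 1)) := by ring
    _ ≤ p * (z ^ p / p + s ^ p / (p / (p - 1))) := by gcongr
    _ = (p - 1) * s ^ p + z ^ p := by field_simp; ring

theorem rpow_sub_one_mul_le_add {p s z : ℝ} (hp : 1 < p) (hs : 0 ≤ s) (hz : 0 ≤ z) :
    s ^ (p - 1) * z ≤ s ^ p + z ^ p := by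
  have h := mul_rpow_mul_le_of_young hp hs hz
  have h1 : 0 ≤ s ^ p := Real.rpow_nonneg hs p
  have h2 : 0 ≤ z ^ p := Real.rpow_nonneg hz p
  have h3 : 0 ≤ s ^ (p - 1) * z := mul_nonneg (Real.rpow_nonneg hs _) hz
  nlinarith

/-- A reverse Fatou lemma with converging majorants. -/
theorem le_integral_of_tendsto_of_le {α : Type*} [MeasurableSpace α] {μ : Measure α}
    {F b : ℕ → α → ℝ} {F₀ b₀ J : α → ℝ} {A : ℝ}
    (hF : ∀ k, Integrable (F k) μ) (hb : ∀ k, Integrable (b k) μ) (hb₀ : Integrable b₀ μ)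
    (hJ : Integrable J μ) (hFb : ∀ k x, F k x ≤ b k x)
    (hFlim : ∀ᵐ x ∂μ, Tendsto (fun k => F k x) atTop (𝓝 (F₀ x)))
    (hblim : ∀ᵐ x ∂μ, Tendsto (fun k => b k x) atTop (𝓝 (b₀ x)))
    (hbint : ∀ k, ∫ x, b k x ∂μ = ∫ x, b₀ x ∂μ) (hFJ : ∀ x, F₀ x ≤ J x)
    (hA : ∀ k, A ≤ ∫ x, F k x ∂μ) : A ≤ ∫ x, J x ∂μ := by
  have hfatou : ∫⁻ x, ENNReal.ofReal (b₀ x - F₀ x) ∂μ ≤ ENNReal.ofReal (∫ x, b₀ x ∂μ - A) := by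
    calc ∫⁻ x, ENNReal.ofReal (b₀ x - F₀ x) ∂μ
        = ∫⁻ x, liminf (fun k => ENNReal.ofReal (b k x - F k x)) atTop ∂μ := by
          refine lintegral_congr_ae ?_
          filter_upwards [hFlim, hblim] with x h1 h2
          exact ((ENNReal.continuous_ofReal.tendsto _).comp (h2.sub h1)).liminf_eq.symm
      _ ≤ liminf (fun k => ∫⁻ x, ENNReal.ofReal (b k x - F k x) ∂μ) atTop :=
          lintegral_liminf_le' fun k =>
            ((hb k).sub (hF k)).aestronglyMeasurable.aemeasurable.ennreal_ofReal
      _ ≤ ENNReal.ofReal (∫ x, b₀ x ∂μ - A) := by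
          refine liminf_le_of_le (by isBoundedDefault) fun c hc => ?_
          obtain ⟨k, hk⟩ := hc.exists
          refine hk.trans ?_
          change ∫⁻ x, ENNReal.ofReal ((b k - F k) x) ∂μ ≤ _
          rw [← ofReal_integral_eq_lintegral_ofReal ((hb k).sub (hF k))
            (Eventually.of_forall fun x => sub_nonneg.2 (hFb k x)),
            integral_sub' (hb k) (hF k), hbint]
          exact ENNReal.ofReal_le_ofReal (by linarith [hA k])
  have h0 : 0 ≤ ∫ x, b₀ x ∂μ - A := by
    have := integral_mono (hF 0) (hb 0) (hFb 0)
    linarith [hA 0, hbint 0]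
  have h1 : ENNReal.ofReal (∫ x, (b₀ x - J x) ∂μ) ≤ ENNReal.ofReal (∫ x, b₀ x ∂μ - A) := by
    calc ENNReal.ofReal (∫ x, (b₀ x - J x) ∂μ)
        ≤ ∫⁻ x, ENNReal.ofReal (b₀ x - J x) ∂μ := by
          change ENNReal.ofReal (∫ x, (b₀ - J) x ∂μ) ≤ _
          rw [integral_eq_lintegral_pos_part_sub_lintegral_neg_part (hb₀.sub hJ)]
          refine (ENNReal.ofReal_le_ofReal (sub_le_self _ ENNReal.toReal_nonneg)).trans ?_
          exact ENNReal.ofReal_toReal_le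
      _ ≤ ∫⁻ x, ENNReal.ofReal (b₀ x - F₀ x) ∂μ :=
          lintegral_mono fun x => ENNReal.ofReal_le_ofReal (by linarith [hFJ x])
      _ ≤ _ := hfatou
  have h2 := (ENNReal.ofReal_le_ofReal_iff h0).1 h1
  rw [integral_sub hb₀ hJ] at h2
  linarith

/-- On the part of `Ω` at a distance from the boundary, the gradient of the mollification of `u` is
the mollification of its weak gradient. -/
theorem hasGradientAt_convolution_of_weak_gradient {n : ℕ} {Ω K : Set (Euc n)}
    {u : Euc n → ℝ} {du : Euc n → Euc n} {η : Euc n → ℝ} {x : Euc n}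
    (hK : MeasurableSet K) (hKΩ : K ⊆ Ω) (hu : IntegrableOn u K) (hdu : IntegrableOn du K)
    (hweak : ∀ ψ : Euc n → ℝ, ContDiff ℝ (⊤ : ℕ∞) ψ → HasCompactSupport ψ → tsupport ψ ⊆ Ω →
      ∀ i : Fin n, ∫ x in Ω, u x * fderiv ℝ ψ x (EuclideanSpace.single i 1)
        = - ∫ x in Ω, du x i * ψ x)
    (hη : ContDiff ℝ (⊤ : ℕ∞) η) (hηc : HasCompactSupport η)
    (hηK : tsupport (fun y => η (x - y)) ⊆ K) :
    HasGradientAt (η ⋆[ContinuousLinearMap.lsmul ℝ ℝ, volume] K.indicator u)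
      ((η ⋆[ContinuousLinearMap.lsmul ℝ ℝ, volume] K.indicator du) x) x := by
  have huI : Integrable (K.indicator u) := (integrable_indicator_iff hK).2 hu
  have hduI : Integrable (K.indicator du) := (integrable_indicator_iff hK).2 hdu
  have hη1 : ContDiff ℝ 1 η := hη.of_le (by exact_mod_cast le_top)
  have hd := hηc.hasFDerivAt_convolution_left (ContinuousLinearMap.lsmul ℝ ℝ) hη1
    huI.locallyIntegrable x
  rw [hasGradientAt_iff_hasFDerivAt]
  refine hd.congr_fderiv (Eq.symm ?_)
  have hψ : ContDiff ℝ (⊤ : ℕ∞) (fun y => η (x - y)) := hη.comp (contDiff_const.sub contDiff_id)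
  have hψc : HasCompactSupport (fun y => η (x - y)) :=
    hηc.comp_homeomorph (Homeomorph.subLeft x)
  have hoff : ∀ y, y ∉ K → fderiv ℝ (fun y => η (x - y)) y = 0 := fun y hy =>
    image_eq_zero_of_notMem_tsupport fun h => hy (hηK (tsupport_fderiv_subset ℝ h))
  have hoff' : ∀ y, y ∉ K → η (x - y) = 0 := fun y hy =>
    image_eq_zero_of_notMem_tsupport (f := fun y => η (x - y)) fun h => hy (hηK h)
  have hfd : ∀ y, fderiv ℝ (fun y => η (x - y)) y = - fderiv ℝ η (x - y) := fun y => by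
    have h := ((hη1.differentiable one_ne_zero (x - y)).hasFDerivAt.comp y
      ((hasFDerivAt_id y).const_sub x)).fderiv
    ext a
    have := congrArg (fun L : Euc n →L[ℝ] ℝ => L a) h
    simpa [Function.comp_def] using this
  apply ContinuousLinearMap.coe_injective
  refine (EuclideanSpace.basisFun (Fin n) ℝ).toBasis.ext fun i => ?_
  simp only [OrthonormalBasis.coe_toBasis, EuclideanSpace.basisFun_apply,
    ContinuousLinearMap.coe_coe, InnerProductSpace.toDual_apply_apply]
  have hex1 := (hηc.fderiv ℝ).convolutionExists_left
    ((ContinuousLinearMap.lsmul ℝ ℝ).precompL (Euc n)) (hη1.continuous_fderiv one_ne_zero)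
    huI.locallyIntegrable x
  have hex2 := hηc.convolutionExists_left (ContinuousLinearMap.lsmul ℝ ℝ) hη1.continuous
    hduI.locallyIntegrable x
  rw [convolution_eq_swap, convolution_eq_swap,
    ContinuousLinearMap.integral_apply hex1.integrable_swap]
  have hproj : ∀ v : Euc n, ⟪v, EuclideanSpace.single i (1:ℝ)⟫ =
      EuclideanSpace.proj (𝕜 := ℝ) i v := by
    intro v
    simp [EuclideanSpace.inner_single_right]
  rw [hproj, ← ContinuousLinearMap.integral_comp_comm _ hex2.integrable_swap]
  have hw := hweak _ hψ hψc (hηK.trans hKΩ) i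
  rw [setIntegral_eq_integral_of_forall_compl_eq_zero fun y hy => by
      rw [hoff y fun h => hy (hKΩ h)]; simp,
    setIntegral_eq_integral_of_forall_compl_eq_zero fun y hy => by
      rw [hoff' y fun h => hy (hKΩ h), mul_zero]] at hw
  calc _ = ∫ y, du y i * η (x - y) := by
        refine integral_congr_ae (Eventually.of_forall fun y => ?_)
        by_cases hy : y ∈ K
        · simp [hy, mul_comm]
        · simp [hy, hoff' y hy]
    _ = - ∫ y, u y * fderiv ℝ (fun y => η (x - y)) y (EuclideanSpace.single i 1) := by
        rw [hw, neg_neg]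
    _ = _ := by
        rw [← integral_neg]
        refine integral_congr_ae (Eventually.of_forall fun y => ?_)
        have h0 := hoff y
        rw [hfd] at h0
        by_cases hy : y ∈ K
        · simp [hy, hfd, mul_comm, ContinuousLinearMap.precompL_apply]
        · simp [hy, h0 hy, hfd]

theorem exists_contDiff_cutoff {n : ℕ} {K Ω : Set (Euc n)} (hK : IsCompact K) (hΩ : IsOpen Ω)
    (hKΩ : K ⊆ Ω) : ∃ χ : Euc n → ℝ, ContDiff ℝ (⊤ : ℕ∞) χ ∧ HasCompactSupport χ ∧
      tsupport χ ⊆ Ω ∧ (∀ x, 0 ≤ χ x) ∧ ∀ x ∈ K, χ x = 1 := by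
  obtain ⟨L, hL, hKL, hLΩ⟩ := exists_compact_between hK hΩ hKΩ
  obtain ⟨χ, hχ, hr, hs, h1⟩ := exists_contMDiff_support_eq_eq_one_iff (n := (⊤ : ℕ∞))
    (modelWithCornersSelf ℝ (Euc n)) isOpen_interior hK.isClosed hKL
  have hsub : tsupport χ ⊆ L := by
    rw [tsupport, hs]
    exact closure_minimal interior_subset hL.isClosed
  exact ⟨χ, hχ.contDiff, hL.of_isClosed_subset (isClosed_tsupport χ) hsub, hsub.trans hLΩ,
    fun x => (hr (mem_range_self x)).1, fun x hx => (h1 x).1 hx⟩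

theorem inner_gradient_eq_fderiv {n : ℕ} (ψ : Euc n → ℝ) (x v : Euc n) :
    ⟪v, gradient ψ x⟫ = fderiv ℝ ψ x v := by
  simp [inner_gradient_right]

/-- If the flux `‖du‖ ^ (p - 2) • du` is integrable against all gradients of nonnegative test
functions, then `du` is locally measurable. -/
theorem aestronglyMeasurable_of_integrable_flux {n : ℕ} {p : ℝ} (hp : 1 < p) {K Ω : Set (Euc n)}
    (hK : IsCompact K) (hΩ : IsOpen Ω) (hKΩ : K ⊆ Ω) {du : Euc n → Euc n}
    (hdu : IntegrableOn (fun x => ‖du x‖ ^ p) K)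
    (hflux : ∀ ψ : Euc n → ℝ, ContDiff ℝ (⊤ : ℕ∞) ψ → HasCompactSupport ψ → tsupport ψ ⊆ Ω →
      (∀ x, 0 ≤ ψ x) →
      IntegrableOn (fun x => ‖du x‖ ^ (p - 2) * ⟪du x, gradient ψ x⟫) Ω) :
    AEStronglyMeasurable du (volume.restrict K) := by
  obtain ⟨χ, hχ, hχc, hχΩ, hχ0, hχ1⟩ := exists_contDiff_cutoff hK hΩ hKΩ
  have hnorm : AEMeasurable (fun x => ‖du x‖) (volume.restrict K) := by
    refine (hdu.aestronglyMeasurable.aemeasurable.pow_const p⁻¹).congr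
      (Eventually.of_forall fun x => ?_)
    exact Real.rpow_rpow_inv (norm_nonneg _) (by linarith)
  have hcoord : ∀ i, AEMeasurable (fun x => du x i) (volume.restrict K) := by
    intro i
    have he : ContDiff ℝ (⊤ : ℕ∞) (fun x : Euc n => Real.exp (x i)) :=
      (EuclideanSpace.proj (𝕜 := ℝ) i).contDiff.exp
    have hsub : tsupport (fun x => χ x * Real.exp (x i)) ⊆ tsupport χ :=
      tsupport_mul_subset_left
    have h1 := hflux (fun x => χ x * Real.exp (x i)) (hχ.mul he) hχc.mul_right
      (hsub.trans hχΩ) fun x => mul_nonneg (hχ0 x) (Real.exp_pos _).le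
    have h2 := hflux χ hχ hχc hχΩ hχ0
    have m1 := (h1.mono_set hKΩ).aestronglyMeasurable.aemeasurable
    have m2 := (h2.mono_set hKΩ).aestronglyMeasurable.aemeasurable
    have m3 : AEMeasurable (fun x : Euc n => Real.exp (-(x i))) (volume.restrict K) :=
      (by fun_prop : Measurable fun x : Euc n => Real.exp (-(x i))).aemeasurable
    refine ((hnorm.pow_const (2 - p)).mul ((m3.mul m1).sub m2)).congr ?_
    filter_upwards [ae_restrict_mem hK.measurableSet] with x hx
    have hd := (((hχ.differentiable (by simp)) x).hasFDerivAt.mul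
      ((EuclideanSpace.proj (𝕜 := ℝ) i).hasFDerivAt (x := x)).exp).fderiv
    have hd' : fderiv ℝ (fun x => χ x * Real.exp (x i)) x (du x) =
        Real.exp (x i) * (du x i + fderiv ℝ χ x (du x)) := by
      have := congrArg (fun L : Euc n →L[ℝ] ℝ => L (du x)) hd
      simp only [hχ1 x hx] at this
      refine this.trans ?_
      simp
      ring
    simp only [Pi.mul_apply, Pi.sub_apply, inner_gradient_eq_fderiv, hd']
    rw [Real.exp_neg]
    have hexp := (Real.exp_pos (x i)).ne'
    by_cases h0 : du x = 0
    · simp [h0]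
    · have hpos : 0 < ‖du x‖ := norm_pos_iff.2 h0
      have : ‖du x‖ ^ (2 - p) * ‖du x‖ ^ (p - 2) = 1 := by
        rw [← Real.rpow_add hpos]; simp
      field_simp
      linear_combination (du x i) * this
  have : AEMeasurable (fun x => (WithLp.toLp 2 (fun i => du x i) : Euc n)) (volume.restrict K) :=
    (by fun_prop : Measurable (WithLp.toLp 2 : (Fin n → ℝ) → Euc n)).comp_aemeasurable
      (aemeasurable_pi_lambda _ hcoord)
  exact this.aestronglyMeasurable

/-- If the flux fails to be integrable against the gradient of some nonnegative test function, then
the Bochner integral in the supersolution inequality vanishes too often and `ν` vanishes. -/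
theorem measure_eq_zero_of_not_integrable_flux {n : ℕ} {p : ℝ} {K Ω : Set (Euc n)}
    (hK : IsCompact K) (hΩ : IsOpen Ω) (hKΩ : K ⊆ Ω) {ν : Measure (Euc n)}
    [IsFiniteMeasureOnCompacts ν] {du : Euc n → Euc n}
    (hsuper : ∀ ψ : Euc n → ℝ, ContDiff ℝ (⊤ : ℕ∞) ψ → HasCompactSupport ψ → tsupport ψ ⊆ Ω →
      (∀ x, 0 ≤ ψ x) →
      ∫ x, ψ x ∂ν ≤ ∫ x in Ω, ‖du x‖ ^ (p - 2) * ⟪du x, gradient ψ x⟫)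
    {ψ₀ : Euc n → ℝ} (h₀ : ContDiff ℝ (⊤ : ℕ∞) ψ₀) (h₀c : HasCompactSupport ψ₀)
    (h₀Ω : tsupport ψ₀ ⊆ Ω) (h₀0 : ∀ x, 0 ≤ ψ₀ x)
    (hnot : ¬ IntegrableOn (fun x => ‖du x‖ ^ (p - 2) * ⟪du x, gradient ψ₀ x⟫) Ω) :
    ν K = 0 := by
  obtain ⟨χ, hχ, hχc, hχΩ, hχ0, hχ1⟩ := exists_contDiff_cutoff hK hΩ hKΩ
  have hχi : Integrable χ ν := hχ.continuous.integrable_of_hasCompactSupport hχc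
  have h₀i : Integrable ψ₀ ν := h₀.continuous.integrable_of_hasCompactSupport h₀c
  have hle : ∫ x, χ x ∂ν ≤ 0 := by
    by_cases hint : IntegrableOn (fun x => ‖du x‖ ^ (p - 2) * ⟪du x, gradient χ x⟫) Ω
    · have hsum : ¬ IntegrableOn
          (fun x => ‖du x‖ ^ (p - 2) * ⟪du x, gradient (fun y => χ y + ψ₀ y) x⟫) Ω := by
        intro h
        refine hnot ((h.sub hint).congr (Eventually.of_forall fun x => ?_))
        have hd := ((hχ.differentiable (by simp) x).hasFDerivAt.add
          (h₀.differentiable (by simp) x).hasFDerivAt).fderiv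
        have hd' := congrArg (fun L : Euc n →L[ℝ] ℝ => L (du x)) hd
        have hd'' : fderiv ℝ (fun y => χ y + ψ₀ y) x (du x) =
          fderiv ℝ χ x (du x) + fderiv ℝ ψ₀ x (du x) := hd'
        simp only [Pi.sub_apply, inner_gradient_eq_fderiv, hd'']
        ring
      have h := hsuper (fun y => χ y + ψ₀ y) (hχ.add h₀) (hχc.add h₀c)
        ((tsupport_add χ ψ₀).trans (union_subset hχΩ h₀Ω))
        (fun x => add_nonneg (hχ0 x) (h₀0 x))
      rw [integral_undef hsum, integral_add hχi h₀i] at h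
      linarith [integral_nonneg (μ := ν) (f := ψ₀) h₀0]
    · have h := hsuper χ hχ hχc hχΩ hχ0
      rwa [integral_undef hint] at h
  have hKle : ν.real K ≤ ∫ x, χ x ∂ν := by
    rw [← integral_indicator_one hK.measurableSet]
    refine integral_mono_of_nonneg (Eventually.of_forall fun x => indicator_nonneg (by simp) x) hχi
      (Eventually.of_forall fun x => ?_)
    by_cases hx : x ∈ K
    · simp [hx, hχ1 x hx]
    · simp [hx, hχ0 x]
  have hz : ν.real K = 0 := le_antisymm (hKle.trans hle) measureReal_nonneg
  exact (measureReal_eq_zero_iff hK.measure_lt_top.ne).1 hz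

theorem rpow_sub_two_mul_self {p a : ℝ} (hp : 1 < p) (ha : 0 ≤ a) :
    a ^ (p - 2) * a = a ^ (p - 1) := by
  rcases ha.eq_or_lt with rfl | h
  · rw [mul_zero, Real.zero_rpow (by linarith)]
  · rw [← Real.rpow_add_one h.ne']; ring_nf

theorem rpow_sub_one_mul_self {p a : ℝ} (hp : 1 < p) (ha : 0 ≤ a) :
    a ^ (p - 1) * a = a ^ p := by
  rcases ha.eq_or_lt with rfl | h
  · rw [mul_zero, Real.zero_rpow (by linarith)]
  · rw [← Real.rpow_add_one h.ne']; ring_nf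

theorem rpow_sub_two_mul_inner_self {E : Type*} [NormedAddCommGroup E] [InnerProductSpace ℝ E]
    {p : ℝ} (hp : 1 < p) (a : E) : ‖a‖ ^ (p - 2) * ⟪a, a⟫ = ‖a‖ ^ p := by
  rw [real_inner_self_eq_norm_mul_norm, ← mul_assoc, rpow_sub_two_mul_self hp (norm_nonneg a),
    rpow_sub_one_mul_self hp (norm_nonneg a)]

theorem abs_rpow_sub_two_mul_inner_le {E : Type*} [NormedAddCommGroup E] [InnerProductSpace ℝ E]
    {p : ℝ} (hp : 1 < p) (a b : E) :
    |‖a‖ ^ (p - 2) * ⟪a, b⟫| ≤ ‖a‖ ^ (p - 1) * ‖b‖ := by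
  rw [abs_mul, abs_of_nonneg (Real.rpow_nonneg (norm_nonneg a) _),
    ← rpow_sub_two_mul_self hp (norm_nonneg a), mul_assoc]
  exact mul_le_mul_of_nonneg_left (abs_real_inner_le_norm a b) (Real.rpow_nonneg (norm_nonneg a) _)

/-- Picone's inequality for the regularised power `(t ^ 2 + κ ^ 2) ^ (p / 2) - κ ^ p`. -/
theorem regularized_picone {E : Type*} [NormedAddCommGroup E] [InnerProductSpace ℝ E]
    {p ε κ t v : ℝ} (hp : 1 < p) (hε : 0 < ε) (hκ : 0 < κ) (ht : 0 ≤ t) (hv : ε ≤ v) (a z : E) :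
    (1 - p) * v ^ (-p) * ((t ^ 2 + κ ^ 2) ^ (p / 2) - κ ^ p) * (‖a‖ ^ (p - 2) * ⟪a, a⟫) +
      p * v ^ (1 - p) * ((t ^ 2 + κ ^ 2) ^ (p / 2 - 1) * t) * (‖a‖ ^ (p - 2) * ⟪a, z⟫) ≤
    ‖z‖ ^ p + (p - 1) * ε ^ (-p) * κ ^ p * ‖a‖ ^ p := by
  have hv0 : 0 < v := hε.trans_le hv
  have hp0 : 0 < p - 1 := by linarith
  set h := √(t ^ 2 + κ ^ 2) with hh
  have hW : 0 < t ^ 2 + κ ^ 2 := by positivity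
  have hpos : 0 < h := Real.sqrt_pos.2 hW
  have hth : t ≤ h := Real.le_sqrt_of_sq_le (by nlinarith [sq_nonneg κ])
  have e1 : (t ^ 2 + κ ^ 2) ^ (p / 2) = h ^ p := by
    rw [hh, Real.sqrt_eq_rpow, ← Real.rpow_mul hW.le]; ring_nf
  have e2 : (t ^ 2 + κ ^ 2) ^ (p / 2 - 1) = h ^ (p - 2) := by
    rw [hh, Real.sqrt_eq_rpow, ← Real.rpow_mul hW.le]; ring_nf
  rw [e1, e2, rpow_sub_two_mul_inner_self hp]
  have hA : 0 ≤ ‖a‖ ^ p := Real.rpow_nonneg (norm_nonneg a) _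
  have hA1 : 0 ≤ ‖a‖ ^ (p - 1) := Real.rpow_nonneg (norm_nonneg a) _
  have b1 : h ^ (p - 2) * t ≤ h ^ (p - 1) := by
    rw [← rpow_sub_two_mul_self hp hpos.le]
    gcongr
  have b2 : p * v ^ (1 - p) * (h ^ (p - 2) * t) * (‖a‖ ^ (p - 2) * ⟪a, z⟫) ≤
      p * v ^ (1 - p) * h ^ (p - 1) * (‖a‖ ^ (p - 1) * ‖z‖) := by
    have h3 : ‖a‖ ^ (p - 2) * ⟪a, z⟫ ≤ ‖a‖ ^ (p - 1) * ‖z‖ :=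
      (le_abs_self _).trans (abs_rpow_sub_two_mul_inner_le hp a z)
    calc _ ≤ p * v ^ (1 - p) * (h ^ (p - 2) * t) * (‖a‖ ^ (p - 1) * ‖z‖) := by gcongr
      _ ≤ _ := by gcongr
  have hy := mul_rpow_mul_le_of_young (s := h * ‖a‖ / v) (z := ‖z‖) hp (by positivity)
    (norm_nonneg z)
  have d1 : (h * ‖a‖ / v) ^ (p - 1) = v ^ (1 - p) * h ^ (p - 1) * ‖a‖ ^ (p - 1) := by
    rw [Real.div_rpow (by positivity) hv0.le, Real.mul_rpow hpos.le (norm_nonneg a),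
      show (1 - p) = -(p - 1) by ring, Real.rpow_neg hv0.le]
    ring
  have d2 : (h * ‖a‖ / v) ^ p = v ^ (-p) * h ^ p * ‖a‖ ^ p := by
    rw [Real.div_rpow (by positivity) hv0.le, Real.mul_rpow hpos.le (norm_nonneg a),
      Real.rpow_neg hv0.le]
    ring
  rw [d1, d2] at hy
  have hve : v ^ (-p) ≤ ε ^ (-p) := Real.rpow_le_rpow_of_nonpos hε hv (by linarith)
  have b3 : (p - 1) * v ^ (-p) * κ ^ p * ‖a‖ ^ p ≤ (p - 1) * ε ^ (-p) * κ ^ p * ‖a‖ ^ p := by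
    gcongr
  nlinarith

theorem regularized_rpow_nonneg {p κ t : ℝ} (hp : 1 < p) (hκ : 0 < κ) :
    0 ≤ (t ^ 2 + κ ^ 2) ^ (p / 2) - κ ^ p := by
  have h1 : κ ^ p = (κ ^ 2) ^ (p / 2) := by
    rw [← Real.rpow_natCast κ 2, ← Real.rpow_mul hκ.le]
    push_cast
    ring_nf
  rw [h1, sub_nonneg]
  exact Real.rpow_le_rpow (by positivity) (by nlinarith [sq_nonneg t]) (by linarith)

theorem regularized_rpow_zero {p κ : ℝ} (hκ : 0 < κ) :
    ((0 : ℝ) ^ 2 + κ ^ 2) ^ (p / 2) - κ ^ p = 0 := by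
  rw [zero_pow two_ne_zero, zero_add, ← Real.rpow_natCast κ 2, ← Real.rpow_mul hκ.le, sub_eq_zero]
  push_cast
  ring_nf

theorem rpow_sub_le_regularized_rpow {p κ t : ℝ} (hp : 1 < p) (ht : 0 ≤ t) :
    t ^ p - κ ^ p ≤ (t ^ 2 + κ ^ 2) ^ (p / 2) - κ ^ p := by
  have h1 : t ^ p = (t ^ 2) ^ (p / 2) := by
    rw [← Real.rpow_natCast t 2, ← Real.rpow_mul ht]
    push_cast
    ring_nf
  rw [h1]
  gcongr
  nlinarith [sq_nonneg κ]

theorem contDiff_regularized_rpow {n : ℕ} {p κ : ℝ} (hκ : 0 < κ) {φ : Euc n → ℝ}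
    (hφ : ContDiff ℝ (⊤ : ℕ∞) φ) :
    ContDiff ℝ (⊤ : ℕ∞) fun x => (φ x ^ 2 + κ ^ 2) ^ (p / 2) - κ ^ p :=
  (((hφ.pow 2).add contDiff_const).rpow_const_of_ne fun x => by positivity).sub contDiff_const

/-- The test function used in the supersolution inequality, with its gradient. -/
theorem regularized_test_function {n : ℕ} {p ε κ : ℝ} (hε : 0 < ε) (hκ : 0 < κ)
    {φ U : Euc n → ℝ} (hφ : ContDiff ℝ (⊤ : ℕ∞) φ) (hU : ContDiff ℝ (⊤ : ℕ∞) U)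
    (hU0 : ∀ x, 0 ≤ U x) :
    ContDiff ℝ (⊤ : ℕ∞)
      (fun x => (U x + ε) ^ (1 - p) * ((φ x ^ 2 + κ ^ 2) ^ (p / 2) - κ ^ p)) ∧
    tsupport (fun x => (U x + ε) ^ (1 - p) * ((φ x ^ 2 + κ ^ 2) ^ (p / 2) - κ ^ p)) ⊆ tsupport φ ∧
    ∀ x v, fderiv ℝ
        (fun x => (U x + ε) ^ (1 - p) * ((φ x ^ 2 + κ ^ 2) ^ (p / 2) - κ ^ p)) x v =
      (1 - p) * (U x + ε) ^ (-p) * ((φ x ^ 2 + κ ^ 2) ^ (p / 2) - κ ^ p) * fderiv ℝ U x v +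
      p * (U x + ε) ^ (1 - p) * ((φ x ^ 2 + κ ^ 2) ^ (p / 2 - 1) * φ x) * fderiv ℝ φ x v := by
  have hV : ∀ x, U x + ε ≠ 0 := fun x => by have := hU0 x; positivity
  have hW : ∀ x, φ x ^ 2 + κ ^ 2 ≠ 0 := fun x => by positivity
  refine ⟨((hU.add contDiff_const).rpow_const_of_ne hV).mul (contDiff_regularized_rpow hκ hφ),
    closure_mono fun x hx => ?_, fun x v => ?_⟩
  · intro h0
    exact hx (by simp only [h0, regularized_rpow_zero hκ, mul_zero])
  · have d1 := (((hU.differentiable (by simp) x).hasFDerivAt.add_const ε).rpow_const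
      (p := 1 - p) (Or.inl (hV x)))
    have d2 := (((((hφ.differentiable (by simp) x).hasFDerivAt.pow 2).add_const (κ ^ 2)).rpow_const
      (p := p / 2) (Or.inl (hW x))).sub_const (κ ^ p))
    have h := congrArg (fun L : Euc n →L[ℝ] ℝ => L v) (d1.mul d2).fderiv
    refine h.trans ?_
    simp only [_root_.add_apply, _root_.smul_apply, smul_eq_mul]
    rw [show 1 - p - 1 = -p by ring]
    simp
    ring

theorem integral_comp_sub_left_eq_one {n : ℕ} {η : Euc n → ℝ} (hη1 : ∫ y, η y = 1) (x : Euc n) :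
    ∫ y, η (x - y) = 1 := by
  rw [integral_sub_left_eq_self η volume x, hη1]

theorem convolution_nonneg_of_nonneg {n : ℕ} {η f : Euc n → ℝ} (hη0 : ∀ y, 0 ≤ η y)
    (hf : ∀ y, 0 ≤ f y) (x : Euc n) :
    0 ≤ (η ⋆[ContinuousLinearMap.lsmul ℝ ℝ, volume] f) x :=
  integral_nonneg fun y => mul_nonneg (hη0 y) (hf (x - y))

theorem convolution_le_of_le {n : ℕ} {η f : Euc n → ℝ} {M : ℝ} (hη : Continuous η)
    (hηc : HasCompactSupport η) (hη0 : ∀ y, 0 ≤ η y) (hη1 : ∫ y, η y = 1) (hfi : Integrable f)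
    (hf : ∀ y, f y ≤ M) (x : Euc n) :
    (η ⋆[ContinuousLinearMap.lsmul ℝ ℝ, volume] f) x ≤ M := by
  have hex := (hηc.convolutionExists_left (ContinuousLinearMap.lsmul ℝ ℝ) hη
    hfi.locallyIntegrable x).integrable_swap
  rw [convolution_eq_swap]
  calc _ ≤ ∫ y, η (x - y) * M := by
        refine integral_mono hex
          (((hη.integrable_of_hasCompactSupport (μ := volume) hηc).comp_sub_left x).mul_const M)
          fun y => ?_
        exact mul_le_mul_of_nonneg_left (hf y) (hη0 _)
    _ = M := by rw [integral_mul_const, integral_comp_sub_left_eq_one hη1, one_mul]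

theorem rpow_mul_norm_convolution_le {n : ℕ} {η : Euc n → ℝ} {f : Euc n → Euc n} {p : ℝ}
    (hp : 1 < p) (hη : Continuous η) (hηc : HasCompactSupport η) (hη0 : ∀ y, 0 ≤ η y)
    (hη1 : ∫ y, η y = 1) (hfi : Integrable f) (hfp : Integrable fun y => ‖f y‖ ^ p) (x : Euc n) :
    ‖f x‖ ^ (p - 1) * ‖(η ⋆[ContinuousLinearMap.lsmul ℝ ℝ, volume] f) x‖ ≤
      ‖f x‖ ^ p + (η ⋆[ContinuousLinearMap.lsmul ℝ ℝ, volume] fun y => ‖f y‖ ^ p) x := by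
  have hex := (hηc.convolutionExists_left (ContinuousLinearMap.lsmul ℝ ℝ) hη
    hfi.locallyIntegrable x).integrable_swap
  have hexp := (hηc.convolutionExists_left (ContinuousLinearMap.lsmul ℝ ℝ) hη
    hfp.locallyIntegrable x).integrable_swap
  have hηi := (hη.integrable_of_hasCompactSupport (μ := volume) hηc).comp_sub_left x
  rw [convolution_eq_swap, convolution_eq_swap]
  calc _ ≤ ‖f x‖ ^ (p - 1) * ∫ y, ‖ContinuousLinearMap.lsmul ℝ ℝ (η (x - y)) (f y)‖ :=
        mul_le_mul_of_nonneg_left (norm_integral_le_integral_norm _)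
          (Real.rpow_nonneg (norm_nonneg _) _)
    _ = ∫ y, ‖f x‖ ^ (p - 1) * ‖ContinuousLinearMap.lsmul ℝ ℝ (η (x - y)) (f y)‖ :=
        (integral_const_mul _ _).symm
    _ ≤ ∫ y, (η (x - y) * ‖f x‖ ^ p + ContinuousLinearMap.lsmul ℝ ℝ (η (x - y)) (‖f y‖ ^ p)) := by
        refine integral_mono (hex.norm.const_mul _) ((hηi.mul_const _).add hexp) fun y => ?_
        have h := mul_le_mul_of_nonneg_left
          (rpow_sub_one_mul_le_add hp (norm_nonneg (f x)) (norm_nonneg (f y))) (hη0 (x - y))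
        simp only [ContinuousLinearMap.lsmul_apply, norm_smul, Real.norm_eq_abs,
          abs_of_nonneg (hη0 (x - y)), smul_eq_mul]
        linarith
    _ = _ := by
        rw [integral_add (hηi.mul_const _) hexp, integral_mul_const,
          integral_comp_sub_left_eq_one hη1, one_mul]

/-- The weighted inequality with regularisation parameters `ε` and `κ`. -/
theorem regularized_hardy_bound {n : ℕ} {p : ℝ} (hp : 1 < p) {Ω : Set (Euc n)}
    {ν : Measure (Euc n)} [IsFiniteMeasureOnCompacts ν]
    {u : Euc n → ℝ} {du : Euc n → Euc n} {M : ℝ} (hM : 0 ≤ M)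
    (hupos : ∀ x ∈ Ω, 0 < u x) (hubd : ∀ x ∈ Ω, u x ≤ M)
    (hweak : ∀ ψ : Euc n → ℝ, ContDiff ℝ (⊤ : ℕ∞) ψ → HasCompactSupport ψ → tsupport ψ ⊆ Ω →
      ∀ i : Fin n, ∫ x in Ω, u x * fderiv ℝ ψ x (EuclideanSpace.single i 1)
        = - ∫ x in Ω, du x i * ψ x)
    (hsuper : ∀ ψ : Euc n → ℝ, ContDiff ℝ (⊤ : ℕ∞) ψ → HasCompactSupport ψ → tsupport ψ ⊆ Ω →
      (∀ x, 0 ≤ ψ x) →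
      ∫ x, ψ x ∂ν ≤ ∫ x in Ω, ‖du x‖ ^ (p - 2) * ⟪du x, gradient ψ x⟫)
    (hflux : ∀ ψ : Euc n → ℝ, ContDiff ℝ (⊤ : ℕ∞) ψ → HasCompactSupport ψ → tsupport ψ ⊆ Ω →
      (∀ x, 0 ≤ ψ x) →
      IntegrableOn (fun x => ‖du x‖ ^ (p - 2) * ⟪du x, gradient ψ x⟫) Ω)
    {φ : Euc n → ℝ} (hφ : ContDiff ℝ (⊤ : ℕ∞) φ) (hφc : HasCompactSupport φ)
    (hφ0 : ∀ x, 0 ≤ φ x) {δ : ℝ} (hδ : 0 < δ) {K : Set (Euc n)} (hKm : MeasurableSet K)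
    (hKΩ : K ⊆ Ω) (hφK : cthickening δ (tsupport φ) ⊆ K) (hu : IntegrableOn u K)
    (hdu : IntegrableOn du K) (hdup : IntegrableOn (fun x => ‖du x‖ ^ p) K)
    {ε κ : ℝ} (hε : 0 < ε) (hκ : 0 < κ) :
    (M + ε) ^ (1 - p) * ∫ x, ((φ x ^ 2 + κ ^ 2) ^ (p / 2) - κ ^ p) ∂ν ≤
      ∫ x, (‖gradient φ x‖ ^ p + (p - 1) * ε ^ (-p) * κ ^ p * ‖K.indicator du x‖ ^ p) := by
  have hp0 : 0 < p - 1 := by linarith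
  have hφsK : tsupport φ ⊆ K := (self_subset_cthickening _).trans hφK
  set f := K.indicator du with hf
  set w := K.indicator u with hw
  have hwi : Integrable w := (integrable_indicator_iff hKm).2 hu
  have hfi : Integrable f := (integrable_indicator_iff hKm).2 hdu
  have hfp : Integrable fun x => ‖f x‖ ^ p := by
    refine ((integrable_indicator_iff hKm).2 hdup).congr (Eventually.of_forall fun x => ?_)
    by_cases hx : x ∈ K
    · simp [hf, hx]
    · simp [hf, hx, Real.zero_rpow (by linarith : p ≠ 0)]
  have hw0 : ∀ x, 0 ≤ w x := fun x => indicator_nonneg (fun y hy => (hupos y (hKΩ hy)).le) x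
  have hwM : ∀ x, w x ≤ M := fun x => by
    by_cases hx : x ∈ K
    · simpa [hw, hx] using hubd x (hKΩ hx)
    · simpa [hw, hx] using hM
  let B : ℕ → ContDiffBump (0 : Euc n) := fun k =>
    ⟨δ / (k + 1) / 2, δ / (k + 1), by positivity, half_lt_self (by positivity)⟩
  have hBlim : Tendsto (fun k => (B k).rOut) atTop (𝓝 0) :=
    tendsto_const_div_atTop_nhds_zero_nat δ |>.comp (tendsto_add_atTop_nat 1) |>.congr
      fun k => by simp [B]
  have hBratio : ∀ᶠ k in atTop, (B k).rOut ≤ 2 * (B k).rIn :=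
    Eventually.of_forall fun k => by simp [B]; linarith
  have hBδ : ∀ k, (B k).rOut ≤ δ := fun k =>
    div_le_self hδ.le (by have : (0 : ℝ) ≤ k := k.cast_nonneg; linarith)
  let η : ℕ → Euc n → ℝ := fun k => (B k).normed volume
  have hη : ∀ k, ContDiff ℝ (⊤ : ℕ∞) (η k) := fun k => (B k).contDiff_normed
  have hηc : ∀ k, HasCompactSupport (η k) := fun k => (B k).hasCompactSupport_normed
  have hη0 : ∀ k y, 0 ≤ η k y := fun k y => (B k).nonneg_normed y
  have hη1 : ∀ k, ∫ y, η k y = 1 := fun k => (B k).integral_normed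
  have hηK : ∀ k, ∀ x ∈ tsupport φ, tsupport (fun y => η k (x - y)) ⊆ K := by
    intro k x hx
    refine (closure_minimal (fun y hy => ?_) isClosed_closedBall :
      _ ⊆ closedBall x δ).trans ((closedBall_subset_cthickening hx δ).trans hφK)
    have hy' : x - y ∈ Function.support (η k) := hy
    rw [(B k).support_normed_eq, mem_ball_zero_iff] at hy'
    rw [mem_closedBall, dist_comm, dist_eq_norm]
    exact hy'.le.trans (hBδ k)
  let U : ℕ → Euc n → ℝ := fun k => η k ⋆[ContinuousLinearMap.lsmul ℝ ℝ, volume] w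
  let D : ℕ → Euc n → Euc n := fun k => η k ⋆[ContinuousLinearMap.lsmul ℝ ℝ, volume] f
  let g : ℕ → Euc n → ℝ := fun k =>
    η k ⋆[ContinuousLinearMap.lsmul ℝ ℝ, volume] fun y => ‖f y‖ ^ p
  have hU : ∀ k, ContDiff ℝ (⊤ : ℕ∞) (U k) := fun k =>
    (hηc k).contDiff_convolution_left _ (hη k) hwi.locallyIntegrable
  have hU0 : ∀ k x, 0 ≤ U k x := fun k => convolution_nonneg_of_nonneg (hη0 k) hw0
  have hUM : ∀ k x, U k x ≤ M := fun k =>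
    convolution_le_of_le (hη k).continuous (hηc k) (hη0 k) (hη1 k) hwi hwM
  have hUD : ∀ k, ∀ x ∈ tsupport φ, HasGradientAt (U k) (D k x) x := fun k x hx =>
    hasGradientAt_convolution_of_weak_gradient hKm hKΩ hu hdu hweak (hη k) (hηc k) (hηK k x hx)
  let Φ : Euc n → ℝ := fun x => (φ x ^ 2 + κ ^ 2) ^ (p / 2) - κ ^ p
  let Θ : Euc n → ℝ := fun x => (φ x ^ 2 + κ ^ 2) ^ (p / 2 - 1) * φ x
  have hΦ : ContDiff ℝ (⊤ : ℕ∞) Φ := contDiff_regularized_rpow hκ hφ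
  have hΦ0 : ∀ x, 0 ≤ Φ x := fun x => regularized_rpow_nonneg hp hκ
  have hΘ0 : ∀ x, 0 ≤ Θ x := fun x => mul_nonneg (Real.rpow_nonneg (by positivity) _) (hφ0 x)
  have hΦz : ∀ x, φ x = 0 → Φ x = 0 := fun x hx => by
    simp only [Φ, hx, regularized_rpow_zero hκ]
  have hΦc : HasCompactSupport Φ := hφc.mono fun x hx h0 => hx (hΦz x h0)
  have hΘc : HasCompactSupport Θ := hφc.mul_left
  have hWne : ∀ x, φ x ^ 2 + κ ^ 2 ≠ 0 := fun x => by positivity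
  have hΘcont : Continuous Θ :=
    (((hφ.continuous.pow 2).add continuous_const).rpow_const fun x =>
      Or.inl (hWne x)).mul hφ.continuous
  obtain ⟨CΦ, hCΦ⟩ := hΦc.exists_bound_of_continuous hΦ.continuous
  obtain ⟨CΘ, hCΘ⟩ := hΘc.exists_bound_of_continuous hΘcont
  have hCΦ' : ∀ x, Φ x ≤ CΦ := fun x => (le_abs_self _).trans (hCΦ x)
  have hCΘ' : ∀ x, Θ x ≤ CΘ := fun x => (le_abs_self _).trans (hCΘ x)
  have hCΦ0 : 0 ≤ CΦ := (hΦ0 0).trans (hCΦ' 0)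
  have hCΘ0 : 0 ≤ CΘ := (hΘ0 0).trans (hCΘ' 0)
  have hgradc : Continuous (gradient φ) :=
    (InnerProductSpace.toDual ℝ (Euc n)).symm.continuous.comp (hφ.continuous_fderiv (by simp))
  have hgrad0 : ∀ x, x ∉ tsupport φ → gradient φ x = 0 := fun x hx => by
    rw [gradient, image_eq_zero_of_notMem_tsupport fun h => hx (tsupport_fderiv_subset ℝ h),
      map_zero]
  have hgradp : Integrable fun x => ‖gradient φ x‖ ^ p := by
    refine (hgradc.norm.rpow_const fun x => Or.inr (by linarith)).integrable_of_hasCompactSupport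
      (HasCompactSupport.intro hφc fun x hx => ?_)
    rw [hgrad0 x hx, norm_zero, Real.zero_rpow (by linarith)]
  -- the flux paired with the gradient of the `k`-th test function, and its limit
  let F : (Euc n → ℝ) → (Euc n → Euc n) → Euc n → ℝ := fun V E x =>
    (1 - p) * (V x + ε) ^ (-p) * Φ x * (‖f x‖ ^ (p - 2) * ⟪f x, E x⟫) +
      p * (V x + ε) ^ (1 - p) * Θ x * (‖f x‖ ^ (p - 2) * ⟪f x, gradient φ x⟫)
  let b : (Euc n → ℝ) → Euc n → ℝ := fun G x =>
    (p - 1) * ε ^ (-p) * CΦ * (‖f x‖ ^ p + G x) +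
      p * ε ^ (1 - p) * CΘ * (‖f x‖ ^ p + ‖gradient φ x‖ ^ p)
  let ψ : ℕ → Euc n → ℝ := fun k x => (U k x + ε) ^ (1 - p) * Φ x
  have hψ : ∀ k, ContDiff ℝ (⊤ : ℕ∞) (ψ k) ∧ tsupport (ψ k) ⊆ tsupport φ ∧ ∀ x v,
      fderiv ℝ (ψ k) x v = (1 - p) * (U k x + ε) ^ (-p) * Φ x * fderiv ℝ (U k) x v +
        p * (U k x + ε) ^ (1 - p) * Θ x * fderiv ℝ φ x v := fun k =>
    regularized_test_function hε hκ hφ (hU k) (hU0 k)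
  have hψ0 : ∀ k x, 0 ≤ ψ k x := fun k x =>
    mul_nonneg (Real.rpow_nonneg (add_nonneg (hU0 k x) hε.le) _) (hΦ0 x)
  have hψc : ∀ k, HasCompactSupport (ψ k) := fun k =>
    hφc.of_isClosed_subset (isClosed_tsupport _) (hψ k).2.1
  have hψΩ : ∀ k, tsupport (ψ k) ⊆ Ω := fun k => (hψ k).2.1.trans (hφsK.trans hKΩ)
  have hFeq : ∀ k x, ‖du x‖ ^ (p - 2) * ⟪du x, gradient (ψ k) x⟫ = F (U k) (D k) x := by
    intro k x
    rw [inner_gradient_eq_fderiv, (hψ k).2.2]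
    by_cases hx : x ∈ tsupport φ
    · have hfx : f x = du x := indicator_of_mem (hφsK hx) du
      simp only [F, hfx]
      rw [inner_gradient_eq_fderiv, (hUD k x hx).fderiv_apply, real_inner_comm]
      ring
    · have h0 := image_eq_zero_of_notMem_tsupport hx
      have hΘz : Θ x = 0 := by simp [Θ, h0]
      simp [F, hΦz x h0, hΘz]
  have hFoff : ∀ k x, x ∉ Ω → F (U k) (D k) x = 0 := by
    intro k x hx
    have h0 := image_eq_zero_of_notMem_tsupport fun h => hx (hKΩ (hφsK h))
    have hΘz : Θ x = 0 := by simp [Θ, h0]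
    simp [F, hΦz x h0, hΘz]
  have hFint : ∀ k, Integrable (F (U k) (D k)) := by
    intro k
    have h := hflux (ψ k) (hψ k).1 (hψc k) (hψΩ k) (hψ0 k)
    simp only [hFeq] at h
    exact (integrableOn_iff_integrable_of_support_subset fun x hx => by
      by_contra h'
      exact hx (hFoff k x h')).1 h
  have hηi : ∀ k, Integrable (η k) := fun k => (B k).integrable_normed
  have hgi : ∀ k, Integrable (g k) := fun k => (hηi k).integrable_convolution _ hfp
  have hbint : ∀ G : Euc n → ℝ, Integrable G → Integrable (b G) := fun G hG =>
    ((hfp.add hG).const_mul _).add ((hfp.add hgradp).const_mul _)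
  have hΦν : Integrable Φ ν := hΦ.continuous.integrable_of_hasCompactSupport hΦc
  refine le_integral_of_tendsto_of_le (F := fun k => F (U k) (D k)) (b := fun k => b (g k))
    (F₀ := F w f) (b₀ := b fun y => ‖f y‖ ^ p) hFint (fun k => hbint _ (hgi k)) (hbint _ hfp)
    (hgradp.add (hfp.const_mul _)) (fun k x => ?_) ?_ ?_ (fun k => ?_) (fun x => ?_) (fun k => ?_)
  · have hV : ε ≤ U k x + ε := by linarith [hU0 k x]
    have hV0 : 0 < U k x + ε := hε.trans_le hV
    have r1 : (U k x + ε) ^ (-p) ≤ ε ^ (-p) := Real.rpow_le_rpow_of_nonpos hε hV (by linarith)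
    have r2 : (U k x + ε) ^ (1 - p) ≤ ε ^ (1 - p) :=
      Real.rpow_le_rpow_of_nonpos hε hV (by linarith)
    have s1 : -(‖f x‖ ^ (p - 2) * ⟪f x, D k x⟫) ≤ ‖f x‖ ^ p + g k x :=
      ((neg_le_abs _).trans (abs_rpow_sub_two_mul_inner_le hp _ _)).trans
        (rpow_mul_norm_convolution_le hp (hη k).continuous (hηc k) (hη0 k) (hη1 k) hfi hfp x)
    have s2 : ‖f x‖ ^ (p - 2) * ⟪f x, gradient φ x⟫ ≤ ‖f x‖ ^ p + ‖gradient φ x‖ ^ p :=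
      ((le_abs_self _).trans (abs_rpow_sub_two_mul_inner_le hp _ _)).trans
        (rpow_sub_one_mul_le_add hp (norm_nonneg _) (norm_nonneg _))
    have hg0 : 0 ≤ g k x :=
      convolution_nonneg_of_nonneg (hη0 k) (fun y => Real.rpow_nonneg (norm_nonneg _) _) x
    have t1 := hΦ0 x
    have t2 := hΘ0 x
    calc F (U k) (D k) x
        = (p - 1) * (U k x + ε) ^ (-p) * Φ x * (-(‖f x‖ ^ (p - 2) * ⟪f x, D k x⟫)) +
          p * (U k x + ε) ^ (1 - p) * Θ x * (‖f x‖ ^ (p - 2) * ⟪f x, gradient φ x⟫) := by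
          simp only [F]; ring
      _ ≤ (p - 1) * (U k x + ε) ^ (-p) * Φ x * (‖f x‖ ^ p + g k x) +
          p * (U k x + ε) ^ (1 - p) * Θ x * (‖f x‖ ^ p + ‖gradient φ x‖ ^ p) := by gcongr
      _ ≤ b (g k) x := by
          simp only [b]
          gcongr
          · exact hCΦ' x
          · exact hCΘ' x
  · filter_upwards [ContDiffBump.ae_convolution_tendsto_right_of_locallyIntegrable hBlim hBratio
      hwi.locallyIntegrable, ContDiffBump.ae_convolution_tendsto_right_of_locallyIntegrable hBlim
      hBratio hfi.locallyIntegrable] with x h1 h2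
    have hV : w x + ε ≠ 0 := by linarith [hw0 x]
    have h3 := (h1.add_const ε).rpow_const (p := -p) (Or.inl hV)
    have h4 := (h1.add_const ε).rpow_const (p := 1 - p) (Or.inl hV)
    have h5 := (tendsto_const_nhds (x := f x)).inner (𝕜 := ℝ) h2
    exact (((h3.const_mul _).mul_const _).mul (h5.const_mul _)).add
      (((h4.const_mul _).mul_const _).mul_const _)
  · filter_upwards [ContDiffBump.ae_convolution_tendsto_right_of_locallyIntegrable hBlim hBratio
      hfp.locallyIntegrable] with x h1
    exact ((h1.const_add _).const_mul _).add_const _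
  · have hgk : ∫ x, g k x = ∫ x, ‖f x‖ ^ p := by
      have h := integral_convolution (μ := volume) (ν := volume) (ContinuousLinearMap.lsmul ℝ ℝ)
        (hηi k) hfp
      rw [hη1 k] at h
      simpa using h
    have hsum : ∀ G : Euc n → ℝ, Integrable G → ∫ x, b G x =
        (p - 1) * ε ^ (-p) * CΦ * ((∫ x, ‖f x‖ ^ p) + ∫ x, G x) +
        ∫ x, p * ε ^ (1 - p) * CΘ * (‖f x‖ ^ p + ‖gradient φ x‖ ^ p) := fun G hG => by
      have h1 : Integrable fun x => (p - 1) * ε ^ (-p) * CΦ * (‖f x‖ ^ p + G x) :=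
        (hfp.add hG).const_mul _
      have h2 : Integrable fun x => p * ε ^ (1 - p) * CΘ * (‖f x‖ ^ p + ‖gradient φ x‖ ^ p) :=
        (hfp.add hgradp).const_mul _
      rw [← integral_add hfp hG, ← integral_const_mul, ← integral_add h1 h2]
    rw [hsum _ (hgi k), hsum _ hfp, hgk]
  · exact regularized_picone hp hε hκ (hφ0 x) (by linarith [hw0 x]) (f x) (gradient φ x)
  · calc (M + ε) ^ (1 - p) * ∫ x, Φ x ∂ν = ∫ x, (M + ε) ^ (1 - p) * Φ x ∂ν :=
          (integral_const_mul _ _).symm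
      _ ≤ ∫ x, ψ k x ∂ν := by
          refine integral_mono (hΦν.const_mul _)
            ((hψ k).1.continuous.integrable_of_hasCompactSupport (hψc k)) fun x => ?_
          refine mul_le_mul_of_nonneg_right ?_ (hΦ0 x)
          exact Real.rpow_le_rpow_of_nonpos (by linarith [hU0 k x]) (by linarith [hUM k x])
            (by linarith)
      _ ≤ ∫ x in Ω, ‖du x‖ ^ (p - 2) * ⟪du x, gradient (ψ k) x⟫ :=
          hsuper (ψ k) (hψ k).1 (hψc k) (hψΩ k) (hψ0 k)
      _ = ∫ x, F (U k) (D k) x := by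
          simp only [hFeq]
          exact setIntegral_eq_integral_of_forall_compl_eq_zero (hFoff k)

/-- If `u ∈ W^{1,p}_loc(Ω)` (with weak gradient `du`) is positive in `Ω`, bounded by `M`, and a
weak supersolution of `−Δ_p u ≥ ν` for a nonnegative Radon measure `ν` on a bounded open
`Ω ⊂ ℝⁿ`, then for every nonnegative `φ ∈ C_c^∞(Ω)` one has
`∫_Ω φ^p dν ≤ M^{p−1} ∫_Ω |∇φ|^p dx` (so that `W_0^{1,p}(Ω)` embeds into `L^p(Ω;ν)`). -/
theorem hardy_type_bound_of_supersolution {n : ℕ} (p : ℝ) (hp : 1 < p)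
    (Ω : Set (Euc n)) (hΩo : IsOpen Ω) (hΩb : Bornology.IsBounded Ω)
    (ν : Measure (Euc n)) [IsFiniteMeasureOnCompacts ν] (hνΩ : ν Ωᶜ = 0)
    (u : Euc n → ℝ) (du : Euc n → Euc n) (M : ℝ)
    (hupos : ∀ x ∈ Ω, 0 < u x) (hubd : ∀ x ∈ Ω, u x ≤ M)
    -- `u ∈ W^{1,p}_loc(Ω)`:
    (huloc : ∀ K : Set (Euc n), IsCompact K → K ⊆ Ω →
      IntegrableOn u K volume ∧ IntegrableOn (fun x => ‖du x‖ ^ p) K volume)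
    -- `du` is the weak gradient of `u` in `Ω`:
    (hweak : ∀ ψ : Euc n → ℝ, ContDiff ℝ (⊤ : ℕ∞) ψ → HasCompactSupport ψ → tsupport ψ ⊆ Ω →
      ∀ i : Fin n, ∫ x in Ω, u x * fderiv ℝ ψ x (EuclideanSpace.single i 1)
        = - ∫ x in Ω, du x i * ψ x)
    -- `u` is a weak supersolution of `−Δ_p u ≥ ν` in `Ω`:
    (hsuper : ∀ ψ : Euc n → ℝ, ContDiff ℝ (⊤ : ℕ∞) ψ → HasCompactSupport ψ → tsupport ψ ⊆ Ω →
      (∀ x, 0 ≤ ψ x) →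
      ∫ x, ψ x ∂ν ≤ ∫ x in Ω, ‖du x‖ ^ (p - 2) * ⟪du x, gradient ψ x⟫) :
    ∀ φ : Euc n → ℝ, ContDiff ℝ (⊤ : ℕ∞) φ → HasCompactSupport φ → tsupport φ ⊆ Ω →
      (∀ x, 0 ≤ φ x) →
      ∫ x, φ x ^ p ∂ν ≤ M ^ (p - 1) * ∫ x in Ω, ‖gradient φ x‖ ^ p := by
  intro φ hφ hφc hφΩ hφ0
  have hp0 : p ≠ 0 := by linarith
  have hgrad_off : ∀ x, x ∉ tsupport φ → gradient φ x = 0 := fun x hx => by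
    rw [gradient, image_eq_zero_of_notMem_tsupport fun h => hx (tsupport_fderiv_subset ℝ h),
      map_zero]
  have hφ_off : ∀ x, x ∉ tsupport φ → φ x ^ p = 0 := fun x hx => by
    rw [image_eq_zero_of_notMem_tsupport hx, Real.zero_rpow hp0]
  rcases Ω.eq_empty_or_nonempty with rfl | ⟨x₀, hx₀⟩
  · have h0 : ∀ x, φ x ^ p = 0 := fun x => hφ_off x fun h => hφΩ h
    simp [h0]
  have hM : 0 < M := (hupos x₀ hx₀).trans_le (hubd x₀ hx₀)
  have hset : ∫ x in Ω, ‖gradient φ x‖ ^ p = ∫ x, ‖gradient φ x‖ ^ p :=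
    setIntegral_eq_integral_of_forall_compl_eq_zero fun x hx => by
      rw [hgrad_off x fun h => hx (hφΩ h), norm_zero, Real.zero_rpow hp0]
  have hK₀ : IsCompact (tsupport φ) := hφc
  by_cases hflux : ∀ ψ : Euc n → ℝ, ContDiff ℝ (⊤ : ℕ∞) ψ → HasCompactSupport ψ →
      tsupport ψ ⊆ Ω → (∀ x, 0 ≤ ψ x) →
      IntegrableOn (fun x => ‖du x‖ ^ (p - 2) * ⟪du x, gradient ψ x⟫) Ω
  swap
  · push Not at hflux
    obtain ⟨ψ₀, h₀, h₀c, h₀Ω, h₀0, hnot⟩ := hflux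
    have hν := measure_eq_zero_of_not_integrable_flux hK₀ hΩo hφΩ hsuper h₀ h₀c h₀Ω h₀0 hnot
    have hae : (fun x => φ x ^ p) =ᵐ[ν] 0 := by
      filter_upwards [measure_eq_zero_iff_ae_notMem.1 hν] with x hx using hφ_off x hx
    rw [integral_congr_ae hae]
    simp only [Pi.zero_apply, integral_zero]
    positivity
  obtain ⟨δ, hδ, hδΩ⟩ := hK₀.exists_cthickening_subset_open hΩo hφΩ
  have hK : IsCompact (cthickening δ (tsupport φ)) := hK₀.cthickening
  obtain ⟨hu, hdup⟩ := huloc _ hK hδΩ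
  have hdum := aestronglyMeasurable_of_integrable_flux hp hK hΩo hδΩ hdup hflux
  have hdu : IntegrableOn du (cthickening δ (tsupport φ)) := by
    have h1 : IntegrableOn (fun _ : Euc n => (1 : ℝ)) (cthickening δ (tsupport φ)) :=
      integrableOn_const hK.measure_lt_top.ne
    refine (h1.add hdup).mono' hdum (Eventually.of_forall fun x => ?_)
    have h := rpow_sub_one_mul_le_add hp zero_le_one (norm_nonneg (du x))
    simpa using h
  set f := (cthickening δ (tsupport φ)).indicator du with hf
  have hgradc : Continuous (gradient φ) :=
    (InnerProductSpace.toDual ℝ (Euc n)).symm.continuous.comp (hφ.continuous_fderiv (by simp))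
  have hgradp : Integrable fun x => ‖gradient φ x‖ ^ p := by
    refine (hgradc.norm.rpow_const fun x => Or.inr (by linarith)).integrable_of_hasCompactSupport
      (HasCompactSupport.intro hφc fun x hx => ?_)
    rw [hgrad_off x hx, norm_zero, Real.zero_rpow hp0]
  have hfp : Integrable fun x => ‖f x‖ ^ p := by
    refine ((integrable_indicator_iff hK.measurableSet).2 hdup).congr
      (Eventually.of_forall fun x => ?_)
    by_cases hx : x ∈ cthickening δ (tsupport φ)
    · simp [hf, hx]
    · simp [hf, hx, Real.zero_rpow hp0]
  have hφp : Integrable (fun x => φ x ^ p) ν :=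
    (hφ.continuous.rpow_const fun x => Or.inr (by linarith)).integrable_of_hasCompactSupport
      (HasCompactSupport.intro hφc hφ_off)
  have hind : Integrable ((tsupport φ).indicator fun _ => (1 : ℝ)) ν :=
    (integrable_indicator_iff hK₀.measurableSet).2 (integrableOn_const hK₀.measure_lt_top.ne)
  -- take both regularisation parameters to zero, with `κ = ε ^ 2`
  have hε : ∀ ε : ℝ, 0 < ε →
      (M + ε) ^ (1 - p) * (∫ x, φ x ^ p ∂ν - ε ^ p * ε ^ p * ν.real (tsupport φ)) ≤
      (∫ x, ‖gradient φ x‖ ^ p) + (p - 1) * ε ^ p * ∫ x, ‖f x‖ ^ p := by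
    intro ε hε
    have hκ : (ε * ε) ^ p = ε ^ p * ε ^ p := Real.mul_rpow hε.le hε.le
    have h := regularized_hardy_bound hp hM.le hupos hubd hweak hsuper hflux hφ hφc hφ0 hδ
      hK.measurableSet hδΩ subset_rfl hu hdu hdup hε (mul_pos hε hε)
    have hΦc : HasCompactSupport fun x => (φ x ^ 2 + (ε * ε) ^ 2) ^ (p / 2) - (ε * ε) ^ p :=
      HasCompactSupport.intro hφc fun x hx => by
        rw [image_eq_zero_of_notMem_tsupport hx, regularized_rpow_zero (mul_pos hε hε)]
    have hle : ∫ x, φ x ^ p ∂ν - ε ^ p * ε ^ p * ν.real (tsupport φ) ≤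
        ∫ x, ((φ x ^ 2 + (ε * ε) ^ 2) ^ (p / 2) - (ε * ε) ^ p) ∂ν := by
      have e : ν.real (tsupport φ) = ∫ x, (tsupport φ).indicator (fun _ => (1 : ℝ)) x ∂ν :=
        (integral_indicator_one hK₀.measurableSet).symm
      rw [e, ← integral_const_mul, ← integral_sub hφp (hind.const_mul _)]
      refine integral_mono (hφp.sub (hind.const_mul _))
        ((contDiff_regularized_rpow (mul_pos hε hε) hφ).continuous.integrable_of_hasCompactSupport
          hΦc) fun x => ?_
      by_cases hx : x ∈ tsupport φ
      · simpa [hx, hκ] using rpow_sub_le_regularized_rpow (κ := ε * ε) hp (hφ0 x)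
      · simpa [hx, hφ_off x hx] using regularized_rpow_nonneg (t := φ x) hp (mul_pos hε hε)
    have hcancel : (p - 1) * ε ^ (-p) * (ε * ε) ^ p = (p - 1) * ε ^ p := by
      rw [hκ, Real.rpow_neg hε.le]
      have := (Real.rpow_pos_of_pos hε p).ne'
      field_simp
    rw [integral_add hgradp (hfp.const_mul _), integral_const_mul, hcancel] at h
    exact (mul_le_mul_of_nonneg_left hle (Real.rpow_nonneg (by linarith) _)).trans h
  have hid : Tendsto (fun ε : ℝ => ε) (𝓝[>] 0) (𝓝 0) := tendsto_id.mono_left nhdsWithin_le_nhds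
  have hpow : Tendsto (fun ε : ℝ => ε ^ p) (𝓝[>] 0) (𝓝 0) := by
    simpa [Real.zero_rpow hp0] using hid.rpow_const (p := p) (Or.inr (by linarith))
  have hMlim : Tendsto (fun ε : ℝ => (M + ε) ^ (1 - p)) (𝓝[>] 0) (𝓝 (M ^ (1 - p))) := by
    simpa using (hid.const_add M).rpow_const (p := 1 - p) (Or.inl (by simpa using hM.ne'))
  have hlim := le_of_tendsto_of_tendsto
    (hMlim.mul (((hpow.mul hpow).mul_const (ν.real (tsupport φ))).const_sub (∫ x, φ x ^ p ∂ν)))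
    (((hpow.const_mul (p - 1)).mul_const (∫ x, ‖f x‖ ^ p)).const_add (∫ x, ‖gradient φ x‖ ^ p))
    (eventually_mem_nhdsWithin.mono fun ε h => hε ε h)
  simp only [mul_zero, zero_mul, sub_zero, add_zero] at hlim
  rw [hset]
  calc ∫ x, φ x ^ p ∂ν = M ^ (p - 1) * (M ^ (1 - p) * ∫ x, φ x ^ p ∂ν) := by
        rw [← mul_assoc, ← Real.rpow_add hM]; simp
    _ ≤ _ := mul_le_mul_of_nonneg_left hlim (Real.rpow_nonneg hM.le _)
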